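/- Let $U \in \mathbb{C}^{m \times r}$ satisfy $U^* U = I_r$, let $V \in \mathbb{C}^{n \times r}$, let $\Sigma \in \mathbb{C}^{r \times r}$ be invertible, and let $X_2 \in \mathbb{C}^{m \times n}$. Define the full operator $A = X_2 V \Sigma^{-1} U^*$ and the projected operator $\tilde{A} = U^* X_2 V \Sigma^{-1}$. Suppose $w \in \mathbb{C}^r$ and $\lambda \in \mathbb{C}$ satisfy $\tilde{A} w = \lambda w$ with $\lambda \ne 0$ and $w \ne 0$. Then the exact DMD mode $\varphi = X_2 V \Sigma^{-1} w$ satisfies $A \varphi = \lambda \varphi$ and $\varphi \ne 0$; i.e., every nonzero eigenvalue of the reduced operator $\tilde{A}$ is an eigenvalue of $A$, with eigenvector given by the exact DMD mode. -/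

import Mathlib

open Matrix

/-- Every nonzero eigenvalue `λ` of the reduced DMD operator
`Ã = Uᴴ X₂ V Σ⁻¹` (with reduced eigenvector `w ≠ 0`) is an eigenvalue of the full operator
`A = X₂ V Σ⁻¹ Uᴴ`, with eigenvector the exact DMD mode `φ = X₂ V Σ⁻¹ w`, which is nonzero. -/
theorem exact_dmd_mode_is_eigenvector {m n r : ℕ}
    (U : Matrix (Fin m) (Fin r) ℂ) (hU : Uᴴ * U = 1)
    (V : Matrix (Fin n) (Fin r) ℂ)
    (Sig : Matrix (Fin r) (Fin r) ℂ) (hSig : IsUnit Sig)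
    (X2 : Matrix (Fin m) (Fin n) ℂ)
    (A : Matrix (Fin m) (Fin m) ℂ) (hA : A = X2 * V * Sig⁻¹ * Uᴴ)
    (Atil : Matrix (Fin r) (Fin r) ℂ) (hAtil : Atil = Uᴴ * X2 * V * Sig⁻¹)
    (w : Fin r → ℂ) (lam : ℂ)
    (heig : Atil.mulVec w = lam • w) (hlam : lam ≠ 0) (hw : w ≠ 0) :
    A.mulVec ((X2 * V * Sig⁻¹).mulVec w) = lam • (X2 * V * Sig⁻¹).mulVec w ∧
      (X2 * V * Sig⁻¹).mulVec w ≠ 0 := by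
  have h : Uᴴ *ᵥ ((X2 * V * Sig⁻¹) *ᵥ w) = lam • w := by
    rw [← heig, hAtil, Matrix.mulVec_mulVec]
    simp only [Matrix.mul_assoc]
  refine ⟨?_, fun h0 => ?_⟩
  · rw [hA, ← Matrix.mulVec_mulVec, h, Matrix.mulVec_smul]
  · rw [h0, Matrix.mulVec_zero] at h
    exact (smul_ne_zero hlam hw) h.symm
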